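/- Theorem (Reduce is an ε-halver): Assume 0 < α ≤ 1/8. Then for every power of two n, the map Reduce on pairs of binary arrays of length n is an ε-halver for ε = α²·(⌈log₂(1/α)⌉ + 3); that is, writing (A',B') = Reduce(A,B): if t := ones(A)+ones(B) ≤ n then ones(A') ≤ ε·t, and if z := zeros(A)+zeros(B) ≤ n then zeros(B') ≤ ε·z. -/

import Mathlib

namespace ZZ

/-- A binary array of length `m` in the 0-1 model. -/
abbrev BArr (m : ℕ) := Fin m → Bool

/-- The number of `true` (i.e. 1) entries of a binary array. -/
def ones {m : ℕ} (A : BArr m) : ℕ := (Finset.univ.filter (fun i => A i = true)).card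

/-- The number of `false` (i.e. 0) entries of a binary array. -/
def zeros {m : ℕ} (A : BArr m) : ℕ := (Finset.univ.filter (fun i => A i = false)).card

/-- A map on pairs of binary arrays of length `m`. -/
abbrev PairMap (m : ℕ) := BArr m × BArr m → BArr m × BArr m

/-- The multiset of all `2m` entries of a pair of binary arrays. -/
def entries {m : ℕ} (P : BArr m × BArr m) : Multiset Bool :=
  Multiset.map P.1 Finset.univ.val + Multiset.map P.2 Finset.univ.val

/-- `H` preserves the multiset of the `2m` entries. -/
def MultisetPreserving {m : ℕ} (H : PairMap m) : Prop :=
  ∀ P, entries (H P) = entries P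

/-- `H` is an `ε`-halver. -/
def IsEpsHalver {m : ℕ} (ε : ℝ) (H : PairMap m) : Prop :=
  MultisetPreserving H ∧
  (∀ A B : BArr m, ones A + ones B ≤ m →
    (ones (H (A, B)).1 : ℝ) ≤ ε * ((ones A : ℝ) + (ones B : ℝ))) ∧
  (∀ A B : BArr m, zeros A + zeros B ≤ m →
    (zeros (H (A, B)).2 : ℝ) ≤ ε * ((zeros A : ℝ) + (zeros B : ℝ)))

/-- `H` is an `(ε, lam)`-halver. -/
def IsLamHalver {m : ℕ} (ε lam : ℝ) (H : PairMap m) : Prop :=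
  MultisetPreserving H ∧
  (∀ A B : BArr m, ((ones A : ℝ) + (ones B : ℝ)) ≤ lam * m →
    (ones (H (A, B)).1 : ℝ) ≤ ε * ((ones A : ℝ) + (ones B : ℝ))) ∧
  (∀ A B : BArr m, ((zeros A : ℝ) + (zeros B : ℝ)) ≤ lam * m →
    (zeros (H (A, B)).2 : ℝ) ≤ ε * ((zeros A : ℝ) + (zeros B : ℝ)))

/-- `H` is a `(δ, lam)`-attenuator. -/
def IsAttenuator {m : ℕ} (δ lam : ℝ) (H : PairMap m) : Prop :=
  MultisetPreserving H ∧
  (∀ A B : BArr m, ((ones A : ℝ) + (ones B : ℝ)) ≤ lam * m →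
    (ones (H (A, B)).1 : ℝ) ≤ δ * (ones A : ℝ)) ∧
  (∀ A B : BArr m, ((zeros A : ℝ) + (zeros B : ℝ)) ≤ lam * m →
    (zeros (H (A, B)).2 : ℝ) ≤ δ * (zeros B : ℝ))

theorem pow_split (k : ℕ) : (2:ℕ)^(k+1) = 2^k + 2^k := by
  rw [pow_succ, mul_two]

/-- The first half of a binary array of even length. -/
def fh {m n : ℕ} (h : n = m + m) (A : BArr n) : BArr m :=
  fun i => A ⟨i.1, by have := i.2; omega⟩

/-- The second half of a binary array of even length. -/
def sh {m n : ℕ} (h : n = m + m) (A : BArr n) : BArr m :=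
  fun i => A ⟨m + i.1, by have := i.2; omega⟩

/-- Concatenation of two halves. -/
def glue {m n : ℕ} (h : n = m + m) (A B : BArr m) : BArr n :=
  fun i => if hi : i.1 < m then A ⟨i.1, hi⟩ else B ⟨i.1 - m, by have := i.2; omega⟩

/-- Replace the `2m` entries of the pair by their sorted order
(all `false` entries first, across the first array followed by the second). -/
def sortedPair {m : ℕ} (P : BArr m × BArr m) : BArr m × BArr m :=
  (fun i => decide (zeros P.1 + zeros P.2 ≤ i.1),
   fun i => decide (zeros P.1 + zeros P.2 ≤ m + i.1))

/-- The `Attenuate` algorithm, built from a family of halvers indexed by the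
exponent of the (power of two) array length. -/
def Attenuate (Halver : ∀ k : ℕ, PairMap (2^k)) : ∀ k : ℕ, PairMap (2^k)
  | 0 => sortedPair
  | 1 => sortedPair
  | 2 => sortedPair
  | 3 => sortedPair
  | k+4 => fun P =>
      let pA := Halver (k+3) (fh (pow_split (k+3)) P.1, sh (pow_split (k+3)) P.1)
      let pB := Halver (k+3) (fh (pow_split (k+3)) P.2, sh (pow_split (k+3)) P.2)
      let pM := Attenuate Halver (k+3) (Halver (k+3) (pA.2, pB.1))
      let qA := Halver (k+2) (fh (pow_split (k+2)) pM.1, sh (pow_split (k+2)) pM.1)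
      let qB := Halver (k+2) (fh (pow_split (k+2)) pM.2, sh (pow_split (k+2)) pM.2)
      let qM := Attenuate Halver (k+2) (Halver (k+2) (qA.2, qB.1))
      (glue (pow_split (k+3)) pA.1 (glue (pow_split (k+2)) qA.1 qM.1),
       glue (pow_split (k+3)) (glue (pow_split (k+2)) qM.2 qB.2) pB.2)

/-- The `Reduce` algorithm. -/
def Reduce (Halver : ∀ k : ℕ, PairMap (2^k)) : ∀ k : ℕ, PairMap (2^k)
  | 0 => sortedPair
  | 1 => sortedPair
  | 2 => sortedPair
  | 3 => sortedPair
  | k+4 => fun P => Attenuate Halver (k+4) (Halver (k+4) P)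

/-- The counting form of the `ε`-halver property: `m` is the array length, `t` the total number of
ones, and `a`, `b` are the numbers of ones in the two output arrays. -/
structure HalvesCounts (ε m t a b : ℝ) : Prop where
  total : t = a + b
  left_nonneg : 0 ≤ a
  left_le : a ≤ m
  right_nonneg : 0 ≤ b
  right_le : b ≤ m
  ones_le : t ≤ m → a ≤ ε * t
  zeros_le : m ≤ t → m - b ≤ ε * (2 * m - t)

/-- Exchanging the roles of zeros and ones. -/
theorem HalvesCounts.dual {ε m t a b : ℝ} (h : HalvesCounts ε m t a b) :
    HalvesCounts ε m (2 * m - t) (m - b) (m - a) where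
  total := by linarith [h.total]
  left_nonneg := by linarith [h.right_le]
  left_le := by linarith [h.right_nonneg]
  right_nonneg := by linarith [h.left_le]
  right_le := by linarith [h.left_nonneg]
  ones_le ht := h.zeros_le (by linarith)
  zeros_le ht := by
    have := h.ones_le (by linarith)
    linarith

theorem HalvesCounts.mono {ε δ m t a b : ℝ} (h : HalvesCounts ε m t a b) (hε : ε ≤ δ) :
    HalvesCounts δ m t a b where
  total := h.total
  left_nonneg := h.left_nonneg
  left_le := h.left_le
  right_nonneg := h.right_nonneg
  right_le := h.right_le
  ones_le ht := (h.ones_le ht).trans <|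
    mul_le_mul_of_nonneg_right hε (by linarith [h.total, h.left_nonneg, h.right_nonneg])
  zeros_le ht := (h.zeros_le ht).trans <|
    mul_le_mul_of_nonneg_right hε (by linarith [h.total, h.left_le, h.right_le])

theorem ones_attenuate_counts_le {α h t a b a₁ a₂ b₁ b₂ p q p₁ p₂ q₁ q₂ r s : ℝ}
    (hα0 : 0 < α) (hα : α ≤ 1 / 8)
    (h0 : HalvesCounts α (4 * h) t a b)
    (hA : HalvesCounts α (2 * h) a a₁ a₂) (hB : HalvesCounts α (2 * h) b b₁ b₂)
    (hM : HalvesCounts (4 * α ^ 2) (2 * h) (a₂ + b₁) p q)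
    (hP : HalvesCounts α h p p₁ p₂) (hQ : HalvesCounts α h q q₁ q₂)
    (hR : HalvesCounts (4 * α ^ 2) h (p₂ + q₁) r s) (ht : t ≤ 4 * h) :
    a₁ + p₁ + r ≤ 4 * α ^ 2 * t := by
  obtain ⟨e0, a0, -, b0, -, l0, -⟩ := h0
  obtain ⟨eA, a10, -, a20, -, lA, -⟩ := hA
  obtain ⟨eB, b10, -, b20, b2l, lB, zB⟩ := hB
  obtain ⟨eM, p0, -, q0, -, lM, zM⟩ := hM
  obtain ⟨eP, p10, -, p20, -, lP, -⟩ := hP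
  obtain ⟨eQ, q10, -, q20, -, lQ, zQ⟩ := hQ
  obtain ⟨eR, r0, -, s0, -, lR, zR⟩ := hR
  have t0 : 0 ≤ t := by linarith
  have hsq : α ^ 2 ≤ α / 8 := by nlinarith
  have hsq0 : 0 < α ^ 2 := by positivity
  have ha : a ≤ α * t := l0 ht
  have hat : α * t ≤ t / 8 := by linarith [mul_le_mul_of_nonneg_right hα t0]
  have haa : α * a ≤ α ^ 2 * t := by linarith [mul_le_mul_of_nonneg_left ha hα0.le]
  have ha1 : a₁ ≤ α ^ 2 * t := (lA (by linarith)).trans haa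
  have hst : α ^ 2 * t ≤ t / 64 := by linarith [mul_le_mul_of_nonneg_right hsq t0]
  have hst0 : 0 ≤ α ^ 2 * t := by positivity
  rcases le_or_gt b (2 * h) with hb | hb
  · have hb1 : b₁ ≤ α * t := (lB hb).trans (mul_le_mul_of_nonneg_left (by linarith) hα0.le)
    have hm : a₂ + b₁ ≤ 2 * (α * t) := by linarith
    have hp : p ≤ α ^ 2 * t := by
      have h1 := lM (by linarith)
      have h2 : 4 * α ^ 2 * (a₂ + b₁) ≤ 4 * α ^ 2 * (2 * (α * t)) :=
        mul_le_mul_of_nonneg_left hm (by positivity)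
      linarith [mul_le_mul_of_nonneg_left hat hsq0.le]
    have hp1 : p₁ ≤ α ^ 2 * t := by
      linarith [lP (by linarith), mul_le_mul_of_nonneg_right hα p0]
    have hq1 : q₁ ≤ 2 * (α ^ 2 * t) := by
      have := lQ (by linarith)
      have := mul_le_mul_of_nonneg_left (show q ≤ 2 * (α * t) by linarith) hα0.le
      linarith
    have hr : r ≤ α ^ 2 * t := by
      have h1 := lR (by linarith)
      have h2 : 4 * α ^ 2 * (p₂ + q₁) ≤ 4 * α ^ 2 * (t / 16) :=
        mul_le_mul_of_nonneg_left (by linarith) (by positivity)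
      linarith
    linarith
  · have hzb := zB hb.le
    have htn : 2 * h < t := by linarith
    have hnt : α * (4 * h - t) ≤ (4 * h - t) / 8 := by
      linarith [mul_le_mul_of_nonneg_right hα (sub_nonneg.2 ht)]
    have hm : a₁ + (a₂ + b₁ - 2 * h) ≤ α ^ 2 * t := by
      have : α * (2 * (2 * h) - b) = α * (4 * h - t) + α * a := by rw [e0]; ring
      linarith
    have hsh : α ^ 2 * (2 * h) ≤ α ^ 2 * t := mul_le_mul_of_nonneg_left htn.le hsq0.le
    have hp : p ≤ 5 * (α ^ 2 * t) := by
      rcases le_total (a₂ + b₁) (2 * h) with hm' | hm'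
      · have h1 := lM hm'
        have := mul_le_mul_of_nonneg_left hm' hsq0.le
        linarith
      · have h1 := zM hm'
        have := mul_le_mul_of_nonneg_left hm' hsq0.le
        linarith
    have hap : α * p ≤ 5 / 8 * (α ^ 2 * t) := by
      linarith [mul_le_mul_of_nonneg_right hα p0]
    have hp1 : p₁ ≤ 5 / 8 * (α ^ 2 * t) := (lP (by linarith)).trans hap
    have low : p₂ + q₁ ≤ h → a₁ + p₁ + r ≤ 4 * α ^ 2 * t := fun hlow => by
      have h1 := lR hlow
      have := mul_le_mul_of_nonneg_left hlow hsq0.le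
      linarith
    rcases le_total (p₂ + q₁) h with hlow | hhigh
    · exact low hlow
    rcases le_total q h with hq | hq
    · have := lQ hq
      exact low (by linarith [mul_le_mul_of_nonneg_right hα q0])
    · have h1 := zQ hq
      have h2 := zR hhigh
      have h3 := mul_le_mul_of_nonneg_left hhigh hsq0.le
      have h4 : α * (2 * h - q) = α * p - α * (a₂ + b₁ - 2 * h) := by rw [eM]; ring
      rcases le_total (a₂ + b₁) (2 * h) with hm' | hm'
      · have : -(α * (a₂ + b₁ - 2 * h)) ≤ -(a₂ + b₁ - 2 * h) := by
          linarith [mul_le_mul_of_nonneg_right hα (sub_nonneg.2 hm')]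
        linarith
      · have : 0 ≤ α * (a₂ + b₁ - 2 * h) := mul_nonneg hα0.le (by linarith)
        linarith

theorem attenuate_counts {α h t a b a₁ a₂ b₁ b₂ p q p₁ p₂ q₁ q₂ r s : ℝ}
    (hα0 : 0 < α) (hα : α ≤ 1 / 8)
    (h0 : HalvesCounts α (4 * h) t a b)
    (hA : HalvesCounts α (2 * h) a a₁ a₂) (hB : HalvesCounts α (2 * h) b b₁ b₂)
    (hM : HalvesCounts (4 * α ^ 2) (2 * h) (a₂ + b₁) p q)
    (hP : HalvesCounts α h p p₁ p₂) (hQ : HalvesCounts α h q q₁ q₂)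
    (hR : HalvesCounts (4 * α ^ 2) h (p₂ + q₁) r s) :
    HalvesCounts (4 * α ^ 2) (4 * h) t (a₁ + (p₁ + r)) (s + q₂ + b₂) where
  total := by linarith [h0.total, hA.total, hB.total, hM.total, hP.total, hQ.total, hR.total]
  left_nonneg := by linarith [hA.left_nonneg, hP.left_nonneg, hR.left_nonneg]
  left_le := by linarith [hA.left_le, hP.left_le, hR.left_le]
  right_nonneg := by linarith [hB.right_nonneg, hQ.right_nonneg, hR.right_nonneg]
  right_le := by linarith [hB.right_le, hQ.right_le, hR.right_le]
  ones_le ht := by linarith [ones_attenuate_counts_le hα0 hα h0 hA hB hM hP hQ hR ht]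
  zeros_le ht := by
    have key := ones_attenuate_counts_le (h := h) (t := 2 * (4 * h) - t) (a := 4 * h - b)
      (b := 4 * h - a) (a₁ := 2 * h - b₂) (a₂ := 2 * h - b₁) (b₁ := 2 * h - a₂)
      (b₂ := 2 * h - a₁) (p := 2 * h - q) (q := 2 * h - p) (p₁ := h - q₂) (p₂ := h - q₁)
      (q₁ := h - p₂) (q₂ := h - p₁) (r := h - s) (s := h - r) hα0 hα h0.dual
      (by convert hB.dual using 1; ring) (by convert hA.dual using 1; ring)
      (by convert hM.dual using 1; ring) hQ.dual
      hP.dual (by convert hR.dual using 1; ring) (by linarith)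
    linarith

theorem ones_add_zeros {m : ℕ} (A : BArr m) : ones A + zeros A = m := by
  have := Finset.card_filter_add_card_filter_not (s := (Finset.univ : Finset (Fin m)))
    (fun i => A i = true)
  simpa [ones, zeros] using this

theorem ones_split {m n : ℕ} (h : n = m + m) (A : BArr n) :
    ones (fh h A) + ones (sh h A) = ones A := by
  subst h
  simp only [ones, Finset.card_filter]
  rw [Fin.sum_univ_add]
  rfl

theorem ones_glue {m n : ℕ} (h : n = m + m) (A B : BArr m) :
    ones (glue h A B) = ones A + ones B := by
  rw [← ones_split h]
  congr 2 <;> ext i <;> simp [fh, sh, glue]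

theorem count_true_entries {m : ℕ} (P : BArr m × BArr m) :
    (entries P).count true = ones P.1 + ones P.2 := by
  simp only [entries, Multiset.count_add, Multiset.count_map, ones, Finset.card_def,
    Finset.filter_val, eq_comm]

theorem count_false_entries {m : ℕ} (P : BArr m × BArr m) :
    (entries P).count false = zeros P.1 + zeros P.2 := by
  simp only [entries, Multiset.count_add, Multiset.count_map, zeros, Finset.card_def,
    Finset.filter_val, eq_comm]

theorem isEpsHalver_iff {m : ℕ} {ε : ℝ} {H : PairMap m} :
    IsEpsHalver ε H ↔ ∀ P, HalvesCounts ε m ((ones P.1 : ℝ) + ones P.2)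
      (ones (H P).1) (ones (H P).2) := by
  have hz : ∀ A : BArr m, (zeros A : ℝ) = m - ones A := fun A => by
    rw [eq_sub_iff_add_eq']
    exact_mod_cast ones_add_zeros A
  have hle : ∀ A : BArr m, (ones A : ℝ) ≤ m := fun A => by
    exact_mod_cast (ones_add_zeros A) ▸ Nat.le_add_right _ _
  constructor
  · rintro ⟨hp, h1, h2⟩ ⟨A, B⟩
    refine ⟨?_, by positivity, hle _, by positivity, hle _, fun ht => ?_, fun ht => ?_⟩
    · have := congrArg (Multiset.count true) (hp (A, B))
      rw [count_true_entries, count_true_entries] at this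
      exact_mod_cast this.symm
    · exact h1 A B (by exact_mod_cast ht)
    · have := h2 A B (by
        have : (zeros A : ℝ) + zeros B ≤ m := by
          rw [hz, hz]
          dsimp only at ht
          linarith
        exact_mod_cast this)
      rw [hz, hz, hz] at this
      convert this using 1
      ring
  · refine fun h => ⟨fun P => ?_, fun A B ht => ?_, fun A B ht => ?_⟩
    · have h1 := (h P).total
      ext c
      cases c
      · rw [count_false_entries, count_false_entries]
        have : (zeros (H P).1 : ℝ) + zeros (H P).2 = zeros P.1 + zeros P.2 := by
          simp only [hz]
          linarith
        exact_mod_cast this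
      · rw [count_true_entries, count_true_entries]
        exact_mod_cast h1.symm
    · exact (h (A, B)).ones_le (by exact_mod_cast ht)
    · have ht' : (zeros A : ℝ) + zeros B ≤ m := by exact_mod_cast ht
      rw [hz, hz] at ht'
      have := (h (A, B)).zeros_le (by dsimp only; linarith)
      rw [hz, hz, hz]
      convert this using 1
      ring

theorem IsEpsHalver.mono {m : ℕ} {ε δ : ℝ} {H : PairMap m} (hH : IsEpsHalver ε H) (h : ε ≤ δ) :
    IsEpsHalver δ H :=
  isEpsHalver_iff.2 fun P => (isEpsHalver_iff.1 hH P).mono h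

theorem ones_decide_le (m c d : ℕ) (hd : d ≤ c) :
    ones (fun i : Fin m => decide (c ≤ d + i.1)) = m - (c - d) := by
  induction m with
  | zero => simp [ones]
  | succ m ih =>
    simp only [ones, Finset.card_filter, decide_eq_true_eq] at ih ⊢
    rw [Fin.sum_univ_castSucc]
    simp only [Fin.val_castSucc, Fin.val_last, ih]
    split_ifs <;> omega

theorem halvesCounts_sortedPair {m : ℕ} {ε : ℝ} (hε : 0 ≤ ε) (P : BArr m × BArr m) :
    HalvesCounts ε m ((ones P.1 : ℝ) + ones P.2)
      (ones (sortedPair P).1) (ones (sortedPair P).2) := by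
  have h1 := ones_add_zeros P.1
  have h2 := ones_add_zeros P.2
  have ha : ones (sortedPair P).1 = m - (zeros P.1 + zeros P.2) := by
    simpa [sortedPair] using ones_decide_le m (zeros P.1 + zeros P.2) 0 (Nat.zero_le _)
  have hb : ones (sortedPair P).2 = m - (zeros P.1 + zeros P.2 - m) := by
    rcases le_total m (zeros P.1 + zeros P.2) with h | h
    · exact ones_decide_le m _ m h
    · have : (sortedPair P).2 = fun i : Fin m => decide (0 ≤ 0 + i.1) := by
        ext i
        simp only [sortedPair]
        simp
        omega
      rw [this, ones_decide_le m 0 0 le_rfl]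
      omega
  refine HalvesCounts.mono (ε := 0) ⟨?_, by positivity, ?_, by positivity, ?_, fun ht => ?_,
    fun ht => ?_⟩ hε
  · norm_cast
    omega
  · norm_cast
    omega
  · norm_cast
    omega
  · norm_cast at ht
    rw [ha, Nat.sub_eq_zero_of_le (by omega)]
    simp
  · norm_cast at ht
    rw [hb, Nat.sub_eq_zero_of_le (n := zeros P.1 + zeros P.2) (by omega)]
    simp

theorem isEpsHalver_attenuate_halver {α : ℝ} (hα0 : 0 < α) (hα : α ≤ 1 / 8)
    (Halver : ∀ k : ℕ, PairMap (2 ^ k)) (hH : ∀ k, IsEpsHalver α (Halver k)) (k : ℕ) :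
    IsEpsHalver (4 * α ^ 2) (fun P => Attenuate Halver k (Halver k P)) := by
  have hH' := fun k => isEpsHalver_iff.1 (hH k)
  have base : ∀ k, Attenuate Halver k = sortedPair →
      IsEpsHalver (4 * α ^ 2) (fun P => Attenuate Halver k (Halver k P)) := fun k hk =>
    isEpsHalver_iff.2 fun P => by
      rw [hk, (hH' k P).total]
      exact halvesCounts_sortedPair (by positivity) _
  induction k using Nat.strong_induction_on with
  | _ k ih =>
    match k, ih with
    | 0, _ => exact base 0 rfl
    | 1, _ => exact base 1 rfl
    | 2, _ => exact base 2 rfl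
    | 3, _ => exact base 3 rfl
    | k + 4, ih =>
      have ih3 := isEpsHalver_iff.1 (ih (k + 3) (by omega))
      have ih2 := isEpsHalver_iff.1 (ih (k + 2) (by omega))
      refine isEpsHalver_iff.2 fun P => ?_
      have split : ∀ j (A : BArr (2 ^ (j + 1))),
          (ones (fh (pow_split j) A) : ℝ) + ones (sh (pow_split j) A) = ones A := fun j A => by
        exact_mod_cast ones_split (pow_split j) A
      have e4 : ((2 ^ (k + 4) : ℕ) : ℝ) = 4 * ((2 ^ (k + 2) : ℕ) : ℝ) := by push_cast; ring
      have e3 : ((2 ^ (k + 3) : ℕ) : ℝ) = 2 * ((2 ^ (k + 2) : ℕ) : ℝ) := by push_cast; ring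
      have halves : ∀ j (A : BArr (2 ^ (j + 1))),
          HalvesCounts α ((2 ^ j : ℕ) : ℝ) (ones A)
            (ones (Halver j (fh (pow_split j) A, sh (pow_split j) A)).1)
            (ones (Halver j (fh (pow_split j) A, sh (pow_split j) A)).2) := fun j A =>
        split j A ▸ hH' j (fh (pow_split j) A, sh (pow_split j) A)
      simp only [Attenuate, ones_glue, Nat.cast_add]
      rw [e4]
      have h0 := hH' (k + 4) P
      have hA := halves (k + 3) (Halver (k + 4) P).1
      have hB := halves (k + 3) (Halver (k + 4) P).2
      have hM := ih3 ((Halver (k + 3) (fh (pow_split (k + 3)) (Halver (k + 4) P).1,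
        sh (pow_split (k + 3)) (Halver (k + 4) P).1)).2,
        (Halver (k + 3) (fh (pow_split (k + 3)) (Halver (k + 4) P).2,
          sh (pow_split (k + 3)) (Halver (k + 4) P).2)).1)
      rw [e4] at h0
      rw [e3] at hA hB hM
      exact attenuate_counts hα0 hα h0 hA hB hM (halves (k + 2) _) (halves (k + 2) _) (ih2 (_, _))

/-- **Reduce is an `ε`-halver.**  Given an `α`-halver family with `0 < α ≤ 1/8`,
for every power of two `n = 2^k` the map `Reduce` on pairs of binary arrays of
length `n` is an `ε`-halver for `ε = α²·(⌈log₂ (1/α)⌉ + 3)`. -/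
theorem reduce_is_eps_halver (α : ℝ) (hα0 : 0 < α) (hα : α ≤ 1/8)
    (Halver : ∀ k : ℕ, PairMap (2 ^ k)) (hH : ∀ k, IsEpsHalver α (Halver k)) :
    ∀ k : ℕ, IsEpsHalver (α ^ 2 * ((⌈Real.logb 2 (1 / α)⌉ : ℝ) + 3)) (Reduce Halver k) := by
  have hceil : (1 : ℝ) ≤ (⌈Real.logb 2 (1 / α)⌉ : ℝ) := by
    have hlog : 0 < Real.logb 2 (1 / α) :=
      Real.logb_pos one_lt_two ((one_lt_div hα0).2 (by linarith))
    exact_mod_cast Int.one_le_ceil_iff.2 hlog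
  have hε : 4 * α ^ 2 ≤ α ^ 2 * ((⌈Real.logb 2 (1 / α)⌉ : ℝ) + 3) := by
    nlinarith [sq_nonneg α]
  intro k
  refine IsEpsHalver.mono ?_ hε
  have sorted : ∀ m : ℕ, IsEpsHalver (4 * α ^ 2) (sortedPair (m := m)) := fun m =>
    isEpsHalver_iff.2 (halvesCounts_sortedPair (by positivity))
  match k with
  | 0 => exact sorted _
  | 1 => exact sorted _
  | 2 => exact sorted _
  | 3 => exact sorted _
  | k + 4 => exact isEpsHalver_attenuate_halver hα0 hα Halver hH (k + 4)

end ZZ
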